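/- Let F be a cumulative distribution function with right endpoint x* = sup{x ∈ ℝ : F(x) < 1}, and suppose F lies in the maximum domain of attraction of a GEV distribution with shape parameter ξ ∈ ℝ, i.e. there exist aₙ > 0, bₙ ∈ ℝ such that F(aₙx + bₙ)ⁿ converges, at every continuity point, to a non-degenerate GEV distribution function with shape ξ. For a threshold u < x* with F(u) < 1, define the excess distribution F_u(x) = (F(x+u) − F(u))/(1 − F(u)) for x ≥ 0. Then there exists a positive function u ↦ σ(u) such that lim_{u → x*} sup_{0 < x < x* − u} |F_u(x) − G_{ξ,σ(u)}(x)| = 0, where G_{ξ,σ}(x) = 1 − (1 + ξx/σ)^(−1/ξ) if ξ ≠ 0 and G_{0,σ}(x) = 1 − exp(−x/σ). -/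

import Mathlib

open Filter Topology

/-- The Generalized Extreme Value (GEV) cumulative distribution function with
location `μ`, scale `σ` and shape `ξ`, extended to all of `ℝ` (it equals `0` below
the lower endpoint when `ξ > 0` and `1` above the upper endpoint when `ξ < 0`). -/
noncomputable def gevCDF (μ σ ξ x : ℝ) : ℝ :=
  if ξ = 0 then Real.exp (-Real.exp (-(x - μ) / σ))
  else if 0 < 1 + ξ * (x - μ) / σ then
    Real.exp (-((1 + ξ * (x - μ) / σ) ^ (-1 / ξ : ℝ)))
  else if 0 < ξ then 0 else 1

/-- The Generalized Pareto Distribution (GPD) cumulative distribution function with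
location `0`, scale `σ` and shape `ξ`, for arguments `x ≥ 0`. -/
noncomputable def gpdCDF (σ ξ x : ℝ) : ℝ :=
  if ξ = 0 then 1 - Real.exp (-x / σ) else 1 - (1 + ξ * x / σ) ^ (-1 / ξ : ℝ)

/-- The right endpoint `x* = sup {x : ℝ | F x < 1}` of a distribution function `F`,
taken in the extended reals (it is `+∞` when the set is unbounded above). -/
noncomputable def rightEndpoint (F : ℝ → ℝ) : EReal :=
  sSup ((fun r : ℝ => (r : EReal)) '' {r : ℝ | F r < 1})

/-- The survival function `1 - G` of the standard generalized Pareto distribution. -/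
noncomputable def gpdTail (ξ x : ℝ) : ℝ :=
  if ξ = 0 then Real.exp (-x) else (1 + ξ * x) ^ (-1 / ξ : ℝ)

section Tail

variable {ξ x y : ℝ}

lemma gpdTail_zero (ξ : ℝ) : gpdTail ξ 0 = 1 := by
  simp [gpdTail]

lemma gpdTail_pos (hx : 0 < 1 + ξ * x) : 0 < gpdTail ξ x := by
  unfold gpdTail
  split_ifs
  · exact Real.exp_pos _
  · exact Real.rpow_pos_of_pos hx _

lemma continuousAt_gpdTail (hx : 0 < 1 + ξ * x) : ContinuousAt (gpdTail ξ) x := by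
  unfold gpdTail
  split_ifs
  · fun_prop
  · exact ContinuousAt.rpow_const (by fun_prop) (Or.inl hx.ne')

lemma gpdTail_lt_gpdTail (hx : 0 < 1 + ξ * x) (hy : 0 < 1 + ξ * y) (hxy : x < y) :
    gpdTail ξ y < gpdTail ξ x := by
  unfold gpdTail
  split_ifs with h
  · exact Real.exp_lt_exp.2 (by linarith)
  · rcases lt_or_gt_of_ne h with h | h
    · exact Real.rpow_lt_rpow hy.le (by nlinarith) (div_pos_of_neg_of_neg (by norm_num) h)
    · exact Real.rpow_lt_rpow_of_neg hx (by nlinarith) (div_neg_of_neg_of_pos (by norm_num) h)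

lemma gpdTail_mul_gpdTail (hξ : ξ ≠ 0) (hx : 0 < 1 + ξ * x) (hy : 0 < 1 + ξ * y) :
    gpdTail ξ x * gpdTail ξ y = gpdTail ξ (x + y * (1 + ξ * x)) := by
  simp only [gpdTail, hξ, if_false]
  rw [← Real.mul_rpow hx.le hy.le]
  ring_nf

lemma eventually_nhds_support (hx : 0 < 1 + ξ * x) : ∀ᶠ y in 𝓝 x, 0 < 1 + ξ * y :=
  (show ContinuousAt (fun y => 1 + ξ * y) x by fun_prop).eventually (lt_mem_nhds hx)

lemma support_of_mem_Icc (hx : 0 ≤ x) (hxy : x ≤ y) (hy : 0 < 1 + ξ * y) : 0 < 1 + ξ * x := by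
  rcases le_or_gt 0 ξ with h | h
  · positivity
  · nlinarith

lemma exists_gpdTail_lt (ξ : ℝ) {ε : ℝ} (hε : 0 < ε) :
    ∃ x, 0 ≤ x ∧ 0 < 1 + ξ * x ∧ gpdTail ξ x < ε := by
  set p := min (ε / 2) 1
  have hp : 0 < p := by positivity
  have hp1 : p ≤ 1 := min_le_right _ _
  have hpε : p < ε := (min_le_left _ _).trans_lt (by linarith)
  by_cases hξ : ξ = 0
  · refine ⟨-Real.log p, by linarith [Real.log_nonpos hp.le hp1], by simp [hξ], ?_⟩
    simpa [gpdTail, hξ, Real.exp_log hp] using hpε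
  · have key : 1 + ξ * ((p ^ (-ξ) - 1) / ξ) = p ^ (-ξ) := by field_simp; ring
    refine ⟨(p ^ (-ξ) - 1) / ξ, ?_, by rw [key]; positivity, ?_⟩
    · rcases lt_or_gt_of_ne hξ with h | h
      · exact div_nonneg_of_nonpos
          (sub_nonpos.2 (Real.rpow_le_one hp.le hp1 (by linarith))) h.le
      · exact div_nonneg
          (sub_nonneg.2 (Real.one_le_rpow_of_pos_of_le_one_of_nonpos hp hp1 (by linarith))) h.le
    · simp only [gpdTail, hξ, if_false]
      rw [key, ← Real.rpow_mul hp.le, show -ξ * (-1 / ξ) = 1 by field_simp, Real.rpow_one]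
      exact hpε

lemma gpdCDF_eq (σ ξ x : ℝ) : gpdCDF σ ξ x = 1 - gpdTail ξ (x / σ) := by
  simp only [gpdCDF, gpdTail, mul_div_assoc, neg_div]
  split_ifs <;> rfl

lemma gevCDF_eq_exp_neg_gpdTail {μ σ : ℝ} (hx : 0 < 1 + ξ * ((x - μ) / σ)) :
    gevCDF μ σ ξ x = Real.exp (-gpdTail ξ ((x - μ) / σ)) := by
  simp only [gevCDF, gpdTail, mul_div_assoc, neg_div, hx, if_true]
  split_ifs <;> rfl

lemma continuousAt_gevCDF {μ σ : ℝ} (hx : 0 < 1 + ξ * ((x - μ) / σ)) :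
    ContinuousAt (gevCDF μ σ ξ) x := by
  have hc : ContinuousAt (fun y => (y - μ) / σ) x := by fun_prop
  have h : gevCDF μ σ ξ =ᶠ[𝓝 x] fun y => Real.exp (-gpdTail ξ ((y - μ) / σ)) := by
    filter_upwards [hc.eventually (eventually_nhds_support hx)] with y hy
    exact gevCDF_eq_exp_neg_gpdTail hy
  refine ContinuousAt.congr ?_ h.symm
  exact Real.continuous_exp.continuousAt.comp
    (ContinuousAt.neg (ContinuousAt.comp (g := gpdTail ξ) (continuousAt_gpdTail hx) hc))

end Tail

section Monotone

variable {ι : Type*} {l : Filter ι} {g : ι → ℝ → ℝ} {τ : ℝ → ℝ} {x : ℝ} {w : ι → ℝ}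

/-- Pointwise convergence of antitone functions to a continuous limit is continuous convergence. -/
lemma tendsto_apply_of_antitone (hg : ∀ i, Antitone (g i))
    (hlim : ∀ᶠ y in 𝓝 x, Tendsto (g · y) l (𝓝 (τ y))) (hτ : ContinuousAt τ x)
    (hw : Tendsto w l (𝓝 x)) : Tendsto (fun i => g i (w i)) l (𝓝 (τ x)) := by
  refine tendsto_order.2 ⟨fun c hc => ?_, fun c hc => ?_⟩
  · obtain ⟨y, ⟨hy, hyc⟩, hxy⟩ := (((hlim.and (hτ.eventually (lt_mem_nhds hc))).filter_mono
      nhdsWithin_le_nhds).and (self_mem_nhdsWithin (s := Set.Ioi x))).exists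
    filter_upwards [hy.eventually (lt_mem_nhds hyc), hw.eventually (gt_mem_nhds hxy)] with i h1 h2
    exact h1.trans_le (hg i h2.le)
  · obtain ⟨y, ⟨hy, hyc⟩, hxy⟩ := (((hlim.and (hτ.eventually (gt_mem_nhds hc))).filter_mono
      nhdsWithin_le_nhds).and (self_mem_nhdsWithin (s := Set.Iio x))).exists
    filter_upwards [hy.eventually (gt_mem_nhds hyc), hw.eventually (lt_mem_nhds hxy)] with i h1 h2
    exact (hg i h2.le).trans_lt h1

/-- If antitone functions converge pointwise to a strictly decreasing limit, then convergence of
the values forces convergence of the arguments. -/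
lemma tendsto_of_tendsto_apply_of_antitone (hg : ∀ i, Antitone (g i))
    (hlim : ∀ᶠ y in 𝓝 x, Tendsto (g · y) l (𝓝 (τ y)))
    (hlt : ∀ᶠ y in 𝓝 x, x < y → τ y < τ x) (hgt : ∀ᶠ y in 𝓝 x, y < x → τ x < τ y)
    (hw : Tendsto (fun i => g i (w i)) l (𝓝 (τ x))) : Tendsto w l (𝓝 x) := by
  refine tendsto_order.2 ⟨fun c hc => ?_, fun c hc => ?_⟩
  · obtain ⟨y, ⟨⟨hy, hτ⟩, hcy⟩, hyx⟩ := ((((hlim.and hgt).and (lt_mem_nhds hc)).filter_mono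
      nhdsWithin_le_nhds).and (self_mem_nhdsWithin (s := Set.Iio x))).exists
    filter_upwards [hw.eventually_lt hy (hτ hyx)] with i hi
    exact hcy.trans ((hg i).reflect_lt hi)
  · obtain ⟨y, ⟨⟨hy, hτ⟩, hcy⟩, hxy⟩ := ((((hlim.and hlt).and (gt_mem_nhds hc)).filter_mono
      nhdsWithin_le_nhds).and (self_mem_nhdsWithin (s := Set.Ioi x))).exists
    filter_upwards [hy.eventually_lt hw (hτ hxy)] with i hi
    exact ((hg i).reflect_lt hi).trans hcy

end Monotone

section GpdLimit

variable {ι : Type*} {l : Filter ι} {g : ι → ℝ → ℝ} {ξ x : ℝ} {w : ι → ℝ}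

lemma tendsto_apply_gpdTail (hg : ∀ i, Antitone (g i))
    (hlim : ∀ y, 0 < 1 + ξ * y → Tendsto (g · y) l (𝓝 (gpdTail ξ y)))
    (hx : 0 < 1 + ξ * x) (hw : Tendsto w l (𝓝 x)) :
    Tendsto (fun i => g i (w i)) l (𝓝 (gpdTail ξ x)) :=
  tendsto_apply_of_antitone hg ((eventually_nhds_support hx).mono hlim)
    (continuousAt_gpdTail hx) hw

lemma tendsto_of_tendsto_apply_gpdTail (hg : ∀ i, Antitone (g i))
    (hlim : ∀ y, 0 < 1 + ξ * y → Tendsto (g · y) l (𝓝 (gpdTail ξ y)))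
    (hx : 0 < 1 + ξ * x) (hw : Tendsto (fun i => g i (w i)) l (𝓝 (gpdTail ξ x))) :
    Tendsto w l (𝓝 x) :=
  tendsto_of_tendsto_apply_of_antitone hg ((eventually_nhds_support hx).mono hlim)
    ((eventually_nhds_support hx).mono fun _ hy => gpdTail_lt_gpdTail hx hy)
    ((eventually_nhds_support hx).mono fun _ hy => gpdTail_lt_gpdTail hy hx) hw

/-- Nonnegative antitone functions converging pointwise to the GPD survival function converge
uniformly on the nonnegative part of its support. -/
lemma eventually_forall_abs_sub_gpdTail_le (hg : ∀ i, Antitone (g i)) (hg0 : ∀ i y, 0 ≤ g i y)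
    (hlim : ∀ y, 0 < 1 + ξ * y → Tendsto (g · y) l (𝓝 (gpdTail ξ y))) {ε : ℝ} (hε : 0 < ε) :
    ∀ᶠ i in l, ∀ y, 0 ≤ y → 0 < 1 + ξ * y → |g i y - gpdTail ξ y| ≤ ε := by
  obtain ⟨z, hz0, hz, hzε⟩ := exists_gpdTail_lt ξ (half_pos hε)
  have hunif : TendstoUniformlyOn g (gpdTail ξ) l (Set.Icc 0 z) := by
    refine (tendstoLocallyUniformlyOn_iff_tendstoUniformlyOn_of_compact isCompact_Icc).1 ?_
    refine tendstoLocallyUniformlyOn_iff_forall_tendsto.2 fun y hy => ?_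
    have hD := support_of_mem_Icc hy.1 hy.2 hz
    have h1 : Tendsto (fun p : ι × ℝ => g p.1 p.2) (l ×ˢ 𝓝 y) (𝓝 (gpdTail ξ y)) :=
      tendsto_apply_gpdTail (g := fun p : ι × ℝ => g p.1) (fun p => hg p.1)
        (fun v hv => (hlim v hv).comp tendsto_fst) hD tendsto_snd
    have h2 : Tendsto (fun p : ι × ℝ => gpdTail ξ p.2) (l ×ˢ 𝓝 y) (𝓝 (gpdTail ξ y)) :=
      (continuousAt_gpdTail hD).tendsto.comp tendsto_snd
    exact ((h2.prodMk_nhds h1).mono_right (nhds_le_uniformity _)).mono_left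
      (prod_mono_right _ nhdsWithin_le_nhds)
  filter_upwards [Metric.tendstoUniformlyOn_iff.1 hunif _ (half_pos hε)] with i hi y hy0 hy
  rcases le_or_gt y z with h | h
  · have := hi y ⟨hy0, h⟩
    rw [dist_comm, Real.dist_eq] at this
    linarith
  · have h1 := hi z ⟨hz0, le_rfl⟩
    rw [dist_comm, Real.dist_eq, abs_lt] at h1
    have h2 := gpdTail_lt_gpdTail hz hy h
    have h3 := gpdTail_pos hy
    have h4 := hg i h.le
    have h5 := hg0 i y
    rw [abs_le]
    constructor <;> linarith

end GpdLimit

/-- If `yₙ ^ n → exp (-t)` with `0 ≤ yₙ`, then `n (1 - yₙ) → t`. -/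
lemma tendsto_nat_mul_one_sub_of_tendsto_pow {y : ℕ → ℝ} {t : ℝ} (hy : ∀ n, 0 ≤ y n)
    (h : Tendsto (fun n => y n ^ n) atTop (𝓝 (Real.exp (-t)))) :
    Tendsto (fun n : ℕ => n * (1 - y n)) atTop (𝓝 t) := by
  have hpos : ∀ᶠ n in atTop, 0 < y n := by
    filter_upwards [h.eventually (lt_mem_nhds (Real.exp_pos _)), eventually_gt_atTop 0] with n hn h0
    refine (hy n).lt_of_ne fun h' => ?_
    simp [← h', h0.ne'] at hn
  have hlog : Tendsto (fun n : ℕ => n * Real.log (y n)) atTop (𝓝 (-t)) := by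
    simpa [Function.comp_def] using
      (Real.continuousAt_log (Real.exp_ne_zero _)).tendsto.comp h
  have hlog0 : Tendsto (fun n => Real.log (y n)) atTop (𝓝 0) := by
    have := hlog.mul (tendsto_inv_atTop_nhds_zero_nat (𝕜 := ℝ))
    rw [mul_zero] at this
    refine this.congr' ?_
    filter_upwards [eventually_gt_atTop 0] with n hn
    have : (n : ℝ) ≠ 0 := by exact_mod_cast hn.ne'
    field_simp
  have hy1 : Tendsto y atTop (𝓝 1) := by
    have := (Real.continuous_exp.tendsto 0).comp hlog0
    rw [Real.exp_zero] at this
    refine this.congr' ?_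
    filter_upwards [hpos] with n hn using Real.exp_log hn
  have hneg : Tendsto (fun n : ℕ => -(n * Real.log (y n))) atTop (𝓝 t) := by simpa using hlog.neg
  refine tendsto_of_tendsto_of_tendsto_of_le_of_le' (by simpa using hy1.mul hneg) hneg ?_ ?_
  · filter_upwards [hpos] with n hn
    have h1 := Real.one_sub_inv_le_log_of_pos hn
    have h2 : y n * (1 - (y n)⁻¹) = y n - 1 := by field_simp
    have h3 : y n - 1 ≤ y n * Real.log (y n) := h2 ▸ mul_le_mul_of_nonneg_left h1 hn.le
    have := mul_le_mul_of_nonneg_left h3 n.cast_nonneg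
    linarith
  · filter_upwards [hpos] with n hn
    have := mul_le_mul_of_nonneg_left (Real.log_le_sub_one_of_pos hn) (n.cast_nonneg (α := ℝ))
    linarith

/-- The excesses over `u` of the law with survival function `S`, rescaled by `σ u`, converge along
`l` to the standard generalized Pareto distribution with shape `ξ`. -/
def HasGPDExcess (S : ℝ → ℝ) (l : Filter ℝ) (ξ : ℝ) (σ : ℝ → ℝ) : Prop :=
  ∀ y, 0 < 1 + ξ * y → Tendsto (fun u => S (u + σ u * y) / S u) l (𝓝 (gpdTail ξ y))

section Excess

variable {S : ℝ → ℝ} {l : Filter ℝ} {ξ : ℝ} {σ : ℝ → ℝ}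

lemma antitone_excess (hS : Antitone S) (hS0 : ∀ x, 0 ≤ S x) (hσ : ∀ u, 0 < σ u) (u : ℝ) :
    Antitone fun y => S (u + σ u * y) / S u := fun x y hxy =>
  div_le_div_of_nonneg_right
    (hS (by linarith [mul_le_mul_of_nonneg_left hxy (hσ u).le])) (hS0 u)

lemma exists_hasGPDExcess (hS : Antitone S) (hS0 : ∀ x, 0 ≤ S x)
    (hl : l.HasBasis (fun c => 0 < S c) fun c => {u | c < u ∧ 0 < S u})
    {a b : ℕ → ℝ} (ha : ∀ n, 0 < a n)
    (hlim : ∀ y, 0 < 1 + ξ * y →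
      Tendsto (fun n : ℕ => n * S (a n * y + b n)) atTop (𝓝 (gpdTail ξ y))) :
    ∃ σ : ℝ → ℝ, (∀ u, 0 < σ u) ∧ HasGPDExcess S l ξ σ := by
  have hpos : ∀ᶠ u in l, 0 < S u := by
    have h0 := hlim 0 (by simp)
    rw [gpdTail_zero] at h0
    obtain ⟨n, hn⟩ := (h0.eventually (lt_mem_nhds one_pos)).exists
    exact hl.eventually_iff.2 ⟨_, pos_of_mul_pos_right hn n.cast_nonneg, fun u hu => hu.2⟩
  have hS_lim : Tendsto S l (𝓝[>] 0) := by
    refine tendsto_nhdsWithin_iff.2 ⟨tendsto_order.2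
      ⟨fun c hc => .of_forall fun u => hc.trans_le (hS0 u), fun ε hε => ?_⟩, hpos⟩
    have h0 := hlim 0 (by simp)
    rw [gpdTail_zero] at h0
    obtain ⟨n, ⟨hn0, hn2⟩, hnε⟩ := (((h0.eventually (lt_mem_nhds one_pos)).and
      (h0.eventually (gt_mem_nhds one_lt_two))).and
      (tendsto_natCast_atTop_atTop.eventually (eventually_gt_atTop (2 / ε)))).exists
    have hc : 0 < S (a n * 0 + b n) := pos_of_mul_pos_right hn0 n.cast_nonneg
    refine hl.eventually_iff.2 ⟨_, hc, fun u hu => (hS hu.1.le).trans_lt ?_⟩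
    rw [div_lt_iff₀ hε] at hnε
    exact lt_of_mul_lt_mul_left (hn2.trans hnε) n.cast_nonneg
  set N : ℝ → ℕ := fun u => ⌊(S u)⁻¹⌋₊
  have hinv : Tendsto (fun u => (S u)⁻¹) l atTop := tendsto_inv_nhdsGT_zero.comp hS_lim
  have hN : Tendsto N l atTop := tendsto_nat_floor_atTop.comp hinv
  have hNS : Tendsto (fun u => N u * S u) l (𝓝 1) := by
    simpa [Function.comp_def, N] using (tendsto_nat_floor_div_atTop (R := ℝ)).comp hinv
  have hg : ∀ u, Antitone fun y => N u * S (a (N u) * y + b (N u)) := fun u x y hxy =>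
    mul_le_mul_of_nonneg_left
      (hS (by linarith [mul_le_mul_of_nonneg_left hxy (ha (N u)).le])) (Nat.cast_nonneg _)
  have hglim : ∀ y, 0 < 1 + ξ * y → Tendsto
      (fun u => (fun y => N u * S (a (N u) * y + b (N u))) y) l (𝓝 (gpdTail ξ y)) :=
    fun y hy => (hlim y hy).comp hN
  have hw : Tendsto (fun u => (u - b (N u)) / a (N u)) l (𝓝 0) := by
    refine tendsto_of_tendsto_apply_gpdTail hg hglim (by simp) ?_
    rw [gpdTail_zero]
    refine hNS.congr fun u => ?_
    rw [mul_div_cancel₀ _ (ha _).ne', sub_add_cancel]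
  refine ⟨fun u => a (N u), fun u => ha _, fun y hy => ?_⟩
  have h1 := tendsto_apply_gpdTail hg hglim (w := fun u => (u - b (N u)) / a (N u) + y) hy
    (by simpa using hw.add_const y)
  have h2 := h1.div hNS one_ne_zero
  rw [div_one] at h2
  refine h2.congr' ?_
  filter_upwards [hN.eventually (eventually_gt_atTop 0)] with u hu
  have : (N u : ℝ) ≠ 0 := by exact_mod_cast hu.ne'
  simp only [Pi.div_apply]
  rw [mul_add, mul_div_cancel₀ _ (ha _).ne', mul_div_mul_left _ _ this]
  ring_nf

/-- The pointwise limit of rescaled excesses is uniform, as long as the scaled support of the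
generalized Pareto distribution covers the excesses. -/
lemma HasGPDExcess.eventually_forall_abs_sub_le (h : HasGPDExcess S l ξ σ) (hS : Antitone S)
    (hS0 : ∀ x, 0 ≤ S x) (hσ : ∀ u, 0 < σ u)
    (hsupp : ∀ᶠ u in l, ∀ x, 0 < x → 0 < S (x + u) → 0 < 1 + ξ * (x / σ u))
    {ε : ℝ} (hε : 0 < ε) :
    ∀ᶠ u in l, ∀ x, 0 < x → 0 < S (x + u) →
      |S (x + u) / S u - gpdTail ξ (x / σ u)| ≤ ε := by
  filter_upwards [hsupp, eventually_forall_abs_sub_gpdTail_le (antitone_excess hS hS0 hσ)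
    (fun u y => div_nonneg (hS0 _) (hS0 _)) h hε] with u hu hunif x hx hSx
  have := hunif (x / σ u) (div_nonneg hx.le (hσ u).le) (hu x hx hSx)
  rwa [mul_div_cancel₀ _ (hσ u).ne', add_comm u] at this

lemma HasGPDExcess.congr_scale (h : HasGPDExcess S l ξ σ) (hS : Antitone S)
    (hS0 : ∀ x, 0 ≤ S x) (hσ : ∀ u, 0 < σ u) {σ' : ℝ → ℝ}
    (hσ' : Tendsto (fun u => σ' u / σ u) l (𝓝 1)) : HasGPDExcess S l ξ σ' := fun y hy => by
  have := tendsto_apply_gpdTail (antitone_excess hS hS0 hσ) h hy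
    (w := fun u => σ' u / σ u * y) (by simpa using hσ'.mul_const y)
  refine this.congr fun u => ?_
  rw [← mul_assoc, mul_div_cancel₀ _ (hσ u).ne']

lemma HasGPDExcess.tendsto_add (h : HasGPDExcess S l ξ σ) (hσ : ∀ u, 0 < σ u)
    (hl : l.HasBasis (fun c => 0 < S c) fun c => {u | c < u ∧ 0 < S u})
    {x : ℝ} (hx0 : 0 ≤ x) (hx : 0 < 1 + ξ * x) :
    Tendsto (fun u => u + σ u * x) l l := by
  refine hl.tendsto_right_iff.2 fun c hc => ?_
  filter_upwards [hl.mem_of_mem hc, (h x hx).eventually (lt_mem_nhds (gpdTail_pos hx))]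
    with u hu hpos
  exact ⟨hu.1.trans_le (le_add_of_nonneg_right (mul_nonneg (hσ u).le hx0)),
    (div_pos_iff_of_pos_right hu.2).1 hpos⟩

lemma HasGPDExcess.tendsto_scale_add_div (h : HasGPDExcess S l ξ σ) (hS : Antitone S)
    (hS0 : ∀ x, 0 ≤ S x) (hσ : ∀ u, 0 < σ u)
    (hl : l.HasBasis (fun c => 0 < S c) fun c => {u | c < u ∧ 0 < S u}) (hξ : ξ ≠ 0)
    {x : ℝ} (hx0 : 0 < x) (hx : 0 < 1 + ξ * x) :
    Tendsto (fun u => σ (u + σ u * x) / σ u) l (𝓝 (1 + ξ * x)) := by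
  have hT := h.tendsto_add hσ hl hx0.le hx
  have hD : 0 < 1 + ξ * (x + x * (1 + ξ * x)) := by nlinarith [mul_pos hx hx]
  have hw : Tendsto (fun u => x + σ (u + σ u * x) / σ u * x) l (𝓝 (x + x * (1 + ξ * x))) := by
    refine tendsto_of_tendsto_apply_gpdTail (antitone_excess hS hS0 hσ) h hD ?_
    rw [← gpdTail_mul_gpdTail hξ hx hx]
    refine (((h x hx).comp hT).mul (h x hx)).congr' ?_
    filter_upwards [(h x hx).eventually (lt_mem_nhds (gpdTail_pos hx))] with u hu
    have h1 : S (u + σ u * x) ≠ 0 := by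
      intro h0
      simp [h0] at hu
    simp only [Function.comp_apply]
    rw [div_mul_div_cancel₀ h1]
    congr 2
    have := (hσ u).ne'
    field_simp
    ring
  have := (hw.sub_const x).div_const x
  refine (this.congr fun u => ?_).trans_eq ?_
  · field_simp
    ring
  · congr 1
    field_simp
    ring

/-- For negative shape the survival function vanishes at finite scaled distance from `u`. -/
lemma HasGPDExcess.eventually_eq_zero (h : HasGPDExcess S l ξ σ) (hS : Antitone S)
    (hS0 : ∀ x, 0 ≤ S x) (hσ : ∀ u, 0 < σ u)
    (hl : l.HasBasis (fun c => 0 < S c) fun c => {u | c < u ∧ 0 < S u}) (hξ : ξ < 0)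
    {c : ℝ} (hc : -1 / ξ < c) : ∀ᶠ u in l, S (u + σ u * c) = 0 := by
  set x := -1 / ξ / 2
  have hx0 : 0 < x := half_pos (div_pos_of_neg_of_neg (by norm_num) hξ)
  have hcx : 2 * x < c := by simpa [x, mul_div_cancel₀] using hc
  have hc0 : 0 < c := by linarith
  have hξx : 1 + ξ * x = 1 / 2 := by
    have := hξ.ne
    simp only [x]
    field_simp
    norm_num
  have hx : 0 < 1 + ξ * x := by rw [hξx]; norm_num
  have hq : 1 + ξ * x < 1 - x / c := by
    have : x / c < 1 / 2 := by rw [div_lt_iff₀ hc0]; linarith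
    linarith
  have hr1 : gpdTail ξ x < 1 := by
    simpa [gpdTail_zero] using gpdTail_lt_gpdTail (ξ := ξ) (by simp) hx hx0
  obtain ⟨r, hxr, hr⟩ := exists_between hr1
  have hr0 : 0 < r := (gpdTail_pos hx).trans hxr
  have hev : ∀ᶠ u in l, 0 < S (u + σ u * x) ∧ S (u + σ u * x) ≤ r * S u ∧
      σ (u + σ u * x) ≤ (1 - x / c) * σ u := by
    have hpos : ∀ᶠ u in l, 0 < S (u + σ u * x) ∧ 0 < S u := by
      filter_upwards [(h x hx).eventually (lt_mem_nhds (gpdTail_pos hx))] with u hu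
      refine ⟨(hS0 _).lt_of_ne' fun h0 => ?_, (hS0 _).lt_of_ne' fun h0 => ?_⟩ <;> simp [h0] at hu
    filter_upwards [hpos, (h x hx).eventually (gt_mem_nhds hxr),
      (h.tendsto_scale_add_div hS hS0 hσ hl hξ.ne hx0 hx).eventually (gt_mem_nhds hq)]
      with u hu h1 h2
    exact ⟨hu.1, ((div_lt_iff₀ hu.2).1 h1).le, ((div_lt_iff₀ (hσ u)).1 h2).le⟩
  obtain ⟨d, hd, hdu⟩ := hl.eventually_iff.1 hev
  have key : ∀ k : ℕ, ∀ u, d < u → 0 < S u → S (u + σ u * c) ≤ r ^ k * S u := by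
    intro k
    induction k with
    | zero =>
      intro u _ _
      simpa using hS (le_add_of_nonneg_right (mul_nonneg (hσ u).le hc0.le))
    | succ k ih =>
      intro u hu hSu
      obtain ⟨h1, h2, h3⟩ := hdu ⟨hu, hSu⟩
      have h4 := ih (u + σ u * x) (by linarith [mul_pos (hσ u) hx0]) h1
      have h5 : u + σ u * x + σ (u + σ u * x) * c ≤ u + σ u * c := by
        have h6 := mul_le_mul_of_nonneg_right h3 hc0.le
        have h7 : (1 - x / c) * σ u * c = σ u * c - σ u * x := by
          field_simp
        linarith
      calc S (u + σ u * c) ≤ S (u + σ u * x + σ (u + σ u * x) * c) := hS h5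
        _ ≤ r ^ k * S (u + σ u * x) := h4
        _ ≤ r ^ k * (r * S u) := by gcongr
        _ = r ^ (k + 1) * S u := by ring
  filter_upwards [hl.mem_of_mem hd] with u hu
  refine le_antisymm (ge_of_tendsto' (x := atTop) (f := fun k : ℕ => r ^ k * S u) ?_
    fun k => key k u hu.1 hu.2) (hS0 _)
  simpa using (tendsto_pow_atTop_nhds_zero_of_lt_one hr0.le hr).mul_const (S u)

/-- For negative shape the right endpoint is finite and the distance to it is a valid scale. -/
lemma HasGPDExcess.exists_endpoint (h : HasGPDExcess S l ξ σ) (hS : Antitone S)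
    (hS0 : ∀ x, 0 ≤ S x) (hσ : ∀ u, 0 < σ u) [l.NeBot]
    (hl : l.HasBasis (fun c => 0 < S c) fun c => {u | c < u ∧ 0 < S u})
    (hright : ∀ u, 0 < S u → ∃ v, u < v ∧ 0 < S v) (hξ : ξ < 0) :
    ∃ e : ℝ, (∀ u, 0 < S u → u < e) ∧ HasGPDExcess S l ξ fun u => -ξ * (e - u) := by
  have hzero {c : ℝ} (hc : -1 / ξ < c) := h.eventually_eq_zero hS hS0 hσ hl hξ hc
  have hub {m u : ℝ} (hm : S m = 0) (hu : 0 < S u) : u ≤ m :=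
    le_of_not_gt fun hlt => (hu.trans_le (hS hlt.le)).ne' hm
  obtain ⟨u₀, hu₀⟩ := (hzero (lt_add_one _)).exists
  have hbdd : BddAbove {u | 0 < S u} := ⟨_, fun u hu => hub hu₀ hu⟩
  have hne : {u | 0 < S u}.Nonempty := let ⟨c, hc⟩ := hl.ex_mem; ⟨c, hc⟩
  set e := sSup {u | 0 < S u}
  refine ⟨e, fun u hu => ?_, h.congr_scale hS hS0 hσ ?_⟩
  · obtain ⟨v, huv, hv⟩ := hright u hu
    exact huv.trans_le (le_csSup hbdd hv)
  · have hlim : Tendsto (fun u => (e - u) / σ u) l (𝓝 (-1 / ξ)) := by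
      refine tendsto_order.2 ⟨fun c hc => ?_, fun c hc => ?_⟩
      · obtain ⟨y, hcy, hy⟩ := exists_between hc
        have hD : 0 < 1 + ξ * y := by
          have := (lt_div_iff_of_neg hξ).1 hy
          linarith
        filter_upwards [(h y hD).eventually (lt_mem_nhds (gpdTail_pos hD))] with u hu
        have hpos : 0 < S (u + σ u * y) := (hS0 _).lt_of_ne' fun h0 => by simp [h0] at hu
        have := le_csSup hbdd hpos
        refine hcy.trans_le ((le_div_iff₀ (hσ u)).2 ?_)
        linarith
      · obtain ⟨y, hy, hyc⟩ := exists_between hc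
        filter_upwards [hzero hy] with u hu
        have := csSup_le hne fun v hv => hub hu hv
        refine ((div_le_iff₀ (hσ u)).2 ?_).trans_lt hyc
        linarith
    have := hlim.const_mul (-ξ)
    rw [show -ξ * (-1 / ξ) = 1 by field_simp [hξ.ne]] at this
    simpa only [mul_div_assoc] using this

end Excess

section Endpoint

variable {F : ℝ → ℝ}

lemma exists_gt_lt_one_of_rightContinuous (Frc : ∀ x, ContinuousWithinAt F (Set.Ici x) x) {u : ℝ}
    (hu : F u < 1) : ∃ v, u < v ∧ F v < 1 := by
  obtain ⟨v, hv, huv⟩ := ((((Frc u).mono Set.Ioi_subset_Ici_self).eventually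
    (gt_mem_nhds hu)).and (self_mem_nhdsWithin (s := Set.Ioi u))).exists
  exact ⟨v, huv, hv⟩

lemma coe_lt_rightEndpoint_iff (Fmono : Monotone F)
    (Frc : ∀ x, ContinuousWithinAt F (Set.Ici x) x) (u : ℝ) :
    (u : EReal) < rightEndpoint F ↔ F u < 1 := by
  simp only [rightEndpoint, lt_sSup_iff, Set.exists_mem_image, EReal.coe_lt_coe_iff]
  constructor
  · rintro ⟨v, hv, huv⟩
    exact (Fmono huv.le).trans_lt hv
  · intro hu
    obtain ⟨v, huv, hv⟩ := exists_gt_lt_one_of_rightContinuous Frc hu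
    exact ⟨v, hv, huv⟩

lemma hasBasis_comap_nhdsLT_rightEndpoint (Fmono : Monotone F)
    (Frc : ∀ x, ContinuousWithinAt F (Set.Ici x) x) (hF : ∃ x, F x < 1) :
    (comap (fun u : ℝ => (u : EReal)) (𝓝[<] rightEndpoint F)).HasBasis
      (fun c => F c < 1) (fun c => {u | c < u ∧ F u < 1}) := by
  have hiff := coe_lt_rightEndpoint_iff Fmono Frc
  obtain ⟨x₀, hx₀⟩ := hF
  have hbasis := (nhdsLT_basis_of_exists_lt ⟨_, (hiff x₀).2 hx₀⟩).comap (fun u : ℝ => (u : EReal))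
  refine hbasis.to_hasBasis (fun c hc => ?_) fun c hc =>
    ⟨c, (hiff c).2 hc, fun u hu => ⟨EReal.coe_lt_coe_iff.1 hu.1, (hiff u).1 hu.2⟩⟩
  obtain ⟨d, hcd, hd⟩ := EReal.lt_iff_exists_real_btwn.1 hc
  exact ⟨d, (hiff d).1 hd, fun u hu =>
    ⟨hcd.trans (EReal.coe_lt_coe_iff.2 hu.1), (hiff u).2 hu.2⟩⟩

end Endpoint

/-- **Pickands–Balkema–de Haan theorem.** Let `F` be a CDF with right endpoint
`x* = sup {x | F x < 1}` lying in the maximum domain of attraction of a GEV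
distribution with shape `ξ`, i.e. `F(aₙx + bₙ)ⁿ` converges at continuity points to a
non-degenerate GEV distribution function with shape `ξ`. For `u < x*` let
`F_u(x) = (F(x+u) − F(u))/(1 − F(u))` be the excess distribution. Then there is a
positive scale function `u ↦ σ(u)` such that
`sup_{0 < x < x* − u} |F_u(x) − G_{ξ,σ(u)}(x)| → 0` as `u → x*`. -/
theorem pickands_balkema_de_haan
    (F : ℝ → ℝ) (Fmono : Monotone F)
    (Frc : ∀ x : ℝ, ContinuousWithinAt F (Set.Ici x) x)
    (Fbot : Tendsto F atBot (𝓝 0)) (Ftop : Tendsto F atTop (𝓝 1))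
    (ξ : ℝ)
    (hmda : ∃ (a b : ℕ → ℝ) (μ σ : ℝ), 0 < σ ∧ (∀ n, 0 < a n) ∧
      ∀ x : ℝ, ContinuousAt (gevCDF μ σ ξ) x →
        Tendsto (fun n : ℕ => F (a n * x + b n) ^ n) atTop (𝓝 (gevCDF μ σ ξ x))) :
    ∃ σf : ℝ → ℝ, (∀ u : ℝ, 0 < σf u) ∧
      Tendsto
        (fun u : ℝ => sSup {s : ℝ | ∃ x : ℝ, 0 < x ∧
            ((x + u : ℝ) : EReal) < rightEndpoint F ∧
            s = |(F (x + u) - F u) / (1 - F u) - gpdCDF (σf u) ξ x|})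
        (comap (fun u : ℝ => (u : EReal)) (𝓝[<] rightEndpoint F)) (𝓝 0) := by
  obtain ⟨a, b, μ, σ, hσ, ha, hlim⟩ := hmda
  set S : ℝ → ℝ := fun x => 1 - F x
  set l := comap (fun u : ℝ => (u : EReal)) (𝓝[<] rightEndpoint F)
  have hF0 : ∀ x, 0 ≤ F x := fun x => Fmono.le_of_tendsto Fbot x
  have hF1 : ∀ x, F x ≤ 1 := fun x => Fmono.ge_of_tendsto Ftop x
  have hS : Antitone S := fun x y hxy => sub_le_sub_left (Fmono hxy) 1
  have hS0 : ∀ x, 0 ≤ S x := fun x => sub_nonneg.2 (hF1 x)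
  have hright : ∀ u, 0 < S u → ∃ v, u < v ∧ 0 < S v := fun u hu => by
    simpa [S] using exists_gt_lt_one_of_rightContinuous Frc (sub_pos.1 hu)
  have hFex : ∃ x, F x < 1 := (Fbot.eventually (gt_mem_nhds one_pos)).exists
  have hl : l.HasBasis (fun c => 0 < S c) fun c => {u | c < u ∧ 0 < S u} := by
    simpa only [S, sub_pos] using hasBasis_comap_nhdsLT_rightEndpoint Fmono Frc hFex
  have : l.NeBot := hl.neBot_iff.2 fun {c} hc => hright c hc
  obtain ⟨s, hs, hexc⟩ : ∃ s : ℝ → ℝ, (∀ u, 0 < s u) ∧ HasGPDExcess S l ξ s := by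
    refine exists_hasGPDExcess hS hS0 hl (a := fun n => a n * σ) (b := fun n => a n * μ + b n)
      (fun n => mul_pos (ha n) hσ) fun y hy => ?_
    have hyσ : (σ * y + μ - μ) / σ = y := by
      rw [add_sub_cancel_right, mul_div_cancel_left₀ _ hσ.ne']
    have hD : 0 < 1 + ξ * ((σ * y + μ - μ) / σ) := by rwa [hyσ]
    have h := hlim (σ * y + μ) (continuousAt_gevCDF hD)
    rw [gevCDF_eq_exp_neg_gpdTail hD, hyσ] at h
    refine (tendsto_nat_mul_one_sub_of_tendsto_pow (fun n => hF0 _) h).congr fun n => ?_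
    simp only [S]
    ring_nf
  obtain ⟨σf, hσf, hf, hsupp⟩ : ∃ σf : ℝ → ℝ, (∀ u, 0 < σf u) ∧ HasGPDExcess S l ξ σf ∧
      ∀ᶠ u in l, ∀ x, 0 < x → 0 < S (x + u) → 0 < 1 + ξ * (x / σf u) := by
    rcases le_or_gt 0 ξ with hξ | hξ
    · refine ⟨s, hs, hexc, .of_forall fun u x hx _ => ?_⟩
      have := div_pos hx (hs u)
      positivity
    · obtain ⟨e, he, hexc'⟩ := hexc.exists_endpoint hS hS0 hs hl hright hξ
      have hmem : ∀ᶠ u in l, u < e := by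
        obtain ⟨c, hc⟩ := hl.ex_mem
        filter_upwards [hl.mem_of_mem hc] with u hu using he u hu.2
      refine ⟨fun u => if u < e then -ξ * (e - u) else 1, fun u => ?_, fun y hy => ?_, ?_⟩
      · dsimp only
        split_ifs with hu
        · exact mul_pos (neg_pos.2 hξ) (sub_pos.2 hu)
        · exact one_pos
      · refine (hexc' y hy).congr' ?_
        filter_upwards [hmem] with u hu
        simp only [hu, if_true]
      · filter_upwards [hmem] with u hu x hx hSx
        have hxe := he _ hSx
        have hue : 0 < e - u := sub_pos.2 hu
        have hlt : x / (e - u) < 1 := (div_lt_one hue).2 (by linarith)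
        have heq : ξ * (x / (-ξ * (e - u))) = -(x / (e - u)) := by
          have := hξ.ne
          field_simp
        simp only [hu, if_true]
        linarith
  refine ⟨σf, hσf, tendsto_order.2 ⟨fun c hc => .of_forall fun u => ?_, fun ε hε => ?_⟩⟩
  · refine hc.trans_le (Real.sSup_nonneg ?_)
    rintro _ ⟨x, -, -, rfl⟩
    exact abs_nonneg _
  · obtain ⟨c, hc⟩ := hl.ex_mem
    filter_upwards [hf.eventually_forall_abs_sub_le hS hS0 hσf hsupp (half_pos hε),
      hl.mem_of_mem hc] with u hu hSu
    refine (Real.sSup_le ?_ (half_pos hε).le).trans_lt (half_lt_self hε)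
    rintro _ ⟨x, hx, hxu, rfl⟩
    have hSx : 0 < S (x + u) := sub_pos.2 ((coe_lt_rightEndpoint_iff Fmono Frc _).1 hxu)
    refine le_of_eq_of_le ?_ (hu x hx hSx)
    have hne : 1 - F u ≠ 0 := hSu.2.ne'
    rw [gpdCDF_eq, ← abs_neg]
    congr 1
    simp only [S]
    field_simp
    ring
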